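/- (Lemma A3.4 (ii)) Let η be a real-valued random variable with probability density p, and let ζ be an independent random variable with values in a measurable space 𝒴. Let u, v : 𝒴 → ℝ be measurable with E|v(ζ)| < ∞. Then for P_{η+u(ζ)}-almost all x, E(v(ζ) | η+u(ζ) = x) = E[v(ζ) p(x−u(ζ))] / E[p(x−u(ζ))]; that is, the conditional expectation of v(ζ) given the σ-algebra generated by η+u(ζ) equals h(η+u(ζ)) almost surely, where h(x) = E[v(ζ)p(x−u(ζ))] / E[p(x−u(ζ))] and P_{η+u(ζ)} denotes the distribution of η+u(ζ). -/

import Mathlib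

namespace MeasureTheory

theorem eq_withDensity_of_measureReal_Iic_eq_integral (ρ : Measure ℝ) [IsProbabilityMeasure ρ]
    {p : ℝ → ℝ} (hp0 : ∀ x, 0 ≤ p x)
    (h : ∀ t : ℝ, ρ.real (Set.Iic t) = ∫ x in Set.Iic t, p x) :
    ρ = volume.withDensity fun x => ENNReal.ofReal (p x) := by
  have hint : ∀ t, IntegrableOn p (Set.Iic t) := by
    by_contra! ⟨t, ht⟩
    have hzero : ∀ s, t ≤ s → ρ (Set.Iic s) = 0 := fun s hs => by
      have hs' : ¬ IntegrableOn p (Set.Iic s) := fun hi => ht (hi.mono_set (Set.Iic_subset_Iic.2 hs))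
      have := h s
      rw [integral_undef hs', measureReal_eq_zero_iff] at this
      exact this
    have hlim : Filter.Tendsto (fun s => ρ (Set.Iic s)) Filter.atTop (nhds 0) :=
      tendsto_const_nhds.congr' ((Filter.eventually_ge_atTop t).mono fun s hs => (hzero s hs).symm)
    have := tendsto_nhds_unique hlim (tendsto_measure_Iic_atTop ρ)
    simp at this
  refine Measure.ext_of_Iic _ _ fun t => ?_
  rw [withDensity_apply _ measurableSet_Iic,
    ← ofReal_integral_eq_lintegral_ofReal (hint t) (Filter.Eventually.of_forall hp0), ← h t,
    ofReal_measureReal]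

theorem map_add_prod_withDensity {𝒴 : Type*} [MeasurableSpace 𝒴] (ρ : Measure 𝒴) [SFinite ρ]
    {f : ℝ → ENNReal} (hf : Measurable f) {u : 𝒴 → ℝ} (hu : Measurable u) :
    ((volume.withDensity f).prod ρ).map (fun z => (z.1 + u z.2, z.2)) =
      (volume.prod ρ).withDensity fun z => f (z.1 - u z.2) := by
  have hφ : Measurable fun z : ℝ × 𝒴 => (z.1 + u z.2, z.2) := by fun_prop
  ext s hs
  have hg : Measurable (s.indicator fun z : ℝ × 𝒴 => f (z.1 - u z.2)) :=
    Measurable.indicator (by fun_prop) hs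
  rw [Measure.map_apply hφ hs, prod_withDensity_left hf, withDensity_apply _ (hφ hs),
    withDensity_apply _ hs, ← lintegral_indicator (hφ hs), ← lintegral_indicator hs,
    lintegral_prod_symm' _ (Measurable.indicator (by fun_prop) (hφ hs)),
    lintegral_prod_symm' _ hg]
  refine lintegral_congr fun y => ?_
  rw [← lintegral_add_right_eq_self
    (fun x => s.indicator (fun z : ℝ × 𝒴 => f (z.1 - u z.2)) (x, y)) (u y)]
  refine lintegral_congr fun x => ?_
  simp only [Set.indicator, add_sub_cancel_right]
  rfl

/-- **Bayes' formula** for conditional expectations: if `(X, Y)` has joint density `q` with respect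
to a product measure, then `E[v(Y) | X]` is a ratio of partial integrals of `q`. -/
theorem condExp_comap_ae_eq_of_map_eq_withDensity {Ω α β : Type*} [MeasurableSpace Ω]
    [MeasurableSpace α] [MeasurableSpace β] {μ : Measure Ω} [IsFiniteMeasure μ]
    {κ : Measure α} [SFinite κ] {ρ : Measure β} [SFinite ρ]
    {X : Ω → α} {Y : Ω → β} (hX : Measurable X) (hY : Measurable Y)
    {q : α × β → ℝ} (hqm : Measurable q) (hq0 : ∀ z, 0 ≤ q z)
    (hmap : μ.map (fun ω => (X ω, Y ω)) = (κ.prod ρ).withDensity fun z => ENNReal.ofReal (q z))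
    {v : β → ℝ} (hv : Measurable v) (hvint : Integrable (fun ω => v (Y ω)) μ) :
    μ[(fun ω => v (Y ω)) | MeasurableSpace.comap X inferInstance] =ᵐ[μ] fun ω =>
      (∫ y, v y * q (X ω, y) ∂ρ) / ∫ y, q (X ω, y) ∂ρ := by
  have hXY : Measurable fun ω => (X ω, Y ω) := hX.prodMk hY
  have hqm' : Measurable fun z => ENNReal.ofReal (q z) := hqm.ennreal_ofReal
  have integrable_iff : ∀ {g : α × β → ℝ}, Measurable g →
      (Integrable (fun ω => g (X ω, Y ω)) μ ↔ Integrable (fun z => g z * q z) (κ.prod ρ)) := by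
    intro g hg
    change Integrable (g ∘ fun ω => (X ω, Y ω)) μ ↔ _
    rw [← integrable_map_measure hg.aestronglyMeasurable hXY.aemeasurable, hmap,
      integrable_withDensity_iff hqm' (by simp)]
    simp [ENNReal.toReal_ofReal, hq0]
  have setIntegral_eq : ∀ {g : α × β → ℝ}, Measurable g →
      Integrable (fun z => g z * q z) (κ.prod ρ) → ∀ {s : Set α}, MeasurableSet s →
      ∫ ω in X ⁻¹' s, g (X ω, Y ω) ∂μ = ∫ x in s, ∫ y, g (x, y) * q (x, y) ∂ρ ∂κ := by
    intro g hg hgi s hs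
    have hpre : X ⁻¹' s = (fun ω => (X ω, Y ω)) ⁻¹' (s ×ˢ Set.univ) := by ext; simp
    rw [hpre, ← setIntegral_map (hs.prod MeasurableSet.univ) hg.aestronglyMeasurable
      hXY.aemeasurable, hmap, restrict_withDensity (hs.prod MeasurableSet.univ),
      integral_withDensity_eq_integral_toReal_smul hqm' (by simp),
      setIntegral_prod _ (by
        simpa [ENNReal.toReal_ofReal, hq0, mul_comm] using hgi.integrableOn)]
    simp [ENNReal.toReal_ofReal, hq0, mul_comm]
  have hq_int : Integrable q (κ.prod ρ) := by
    simpa using (integrable_iff (g := fun _ => 1) measurable_const).1 (integrable_const 1)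
  have hvq_int : Integrable (fun z : α × β => v z.2 * q z) (κ.prod ρ) :=
    (integrable_iff (g := fun z => v z.2) (by fun_prop)).1 hvint
  set h : α → ℝ := fun x => (∫ y, v y * q (x, y) ∂ρ) / ∫ y, q (x, y) ∂ρ with h_def
  have hh : Measurable h := by
    refine Measurable.div ?_ ?_
    · have : Measurable fun z : α × β => v z.2 * q z := by fun_prop
      exact this.stronglyMeasurable.integral_prod_right'.measurable
    · exact hqm.stronglyMeasurable.integral_prod_right'.measurable
  have h_mul : ∀ᵐ x ∂κ, h x * ∫ y, q (x, y) ∂ρ = ∫ y, v y * q (x, y) ∂ρ := by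
    filter_upwards [hq_int.prod_right_ae] with x hx
    refine div_mul_cancel_of_imp fun h0 => ?_
    rw [integral_eq_zero_iff_of_nonneg (fun y => hq0 (x, y)) hx] at h0
    refine integral_eq_zero_of_ae ?_
    filter_upwards [h0] with y hy
    simp_all
  have hhq_int : Integrable (fun z : α × β => h z.1 * q z) (κ.prod ρ) := by
    rw [integrable_prod_iff (by fun_prop)]
    refine ⟨?_, ?_⟩
    · filter_upwards [hq_int.prod_right_ae] with x hx using hx.const_mul _
    · refine hvq_int.integral_prod_left.norm.congr ?_
      filter_upwards [h_mul] with x hx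
      simp only [norm_mul, integral_const_mul]
      rw [← hx, norm_mul, Real.norm_of_nonneg (integral_nonneg fun y => hq0 (x, y))]
      simp [abs_of_nonneg, hq0]
  refine (ae_eq_condExp_of_forall_setIntegral_eq hX.comap_le hvint (fun s _ _ => ?_) ?_ ?_).symm
  · exact ((integrable_iff (g := fun z => h z.1) (by fun_prop)).2 hhq_int).integrableOn
  · rintro _ ⟨s, hs, rfl⟩ -
    change ∫ ω in X ⁻¹' s, h (X ω) ∂μ = _
    rw [setIntegral_eq (g := fun z => h z.1) (by fun_prop) hhq_int hs,
      setIntegral_eq (g := fun z => v z.2) (by fun_prop) hvq_int hs]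
    refine integral_congr_ae (ae_restrict_of_ae ?_)
    filter_upwards [h_mul] with x hx
    simp only [integral_const_mul, hx]
  · exact (hh.comp (comap_measurable X)).stronglyMeasurable.aestronglyMeasurable

end MeasureTheory


open MeasureTheory ProbabilityTheory

noncomputable section

/-- Lemma A3.4 (ii): if `η` is a real random variable with density `p` and `ζ` an
independent random variable with values in a measurable space `𝒴`, and
`u, v : 𝒴 → ℝ` are measurable with `E|v(ζ)| < ∞`, then
`E(v(ζ) | η + u(ζ)) = h(η + u(ζ))` a.s., where
`h(x) = E[v(ζ)p(x-u(ζ))] / E[p(x-u(ζ))]`. -/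
theorem conditional_expectation_density_formula_ii
    {Ω : Type*} [MeasurableSpace Ω] (μ : Measure Ω) [IsProbabilityMeasure μ]
    {𝒴 : Type*} [MeasurableSpace 𝒴]
    (η : Ω → ℝ) (ζ : Ω → 𝒴) (hη : Measurable η) (hζ : Measurable ζ)
    (hindep : IndepFun η ζ μ)
    (p : ℝ → ℝ) (hpm : Measurable p) (hp0 : ∀ x, 0 ≤ p x)
    (hdens : ∀ t : ℝ, (μ {ω | η ω ≤ t}).toReal = ∫ x in Set.Iic t, p x)
    (u v : 𝒴 → ℝ) (hu : Measurable u) (hv : Measurable v)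
    (hvint : Integrable (fun ω => v (ζ ω)) μ) :
    μ[(fun ω => v (ζ ω)) |
        MeasurableSpace.comap (fun ω => η ω + u (ζ ω)) (inferInstance : MeasurableSpace ℝ)]
      =ᵐ[μ] fun ω =>
        (∫ ω', v (ζ ω') * p (η ω + u (ζ ω) - u (ζ ω')) ∂μ) /
          (∫ ω', p (η ω + u (ζ ω) - u (ζ ω')) ∂μ) := by
  have := Measure.isProbabilityMeasure_map (μ := μ) hη.aemeasurable
  have hlaw : μ.map η = volume.withDensity fun x => ENNReal.ofReal (p x) :=
    eq_withDensity_of_measureReal_Iic_eq_integral _ hp0 fun t => by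
      rw [← hdens t, map_measureReal_apply hη measurableSet_Iic]
      rfl
  have hjoint : μ.map (fun ω => (η ω + u (ζ ω), ζ ω)) =
      (volume.prod (μ.map ζ)).withDensity fun z => ENNReal.ofReal (p (z.1 - u z.2)) := by
    rw [← map_add_prod_withDensity (μ.map ζ) hpm.ennreal_ofReal hu, ← hlaw,
      ← hindep.map_prod_eq_prod_map_map hη.aemeasurable hζ.aemeasurable,
      Measure.map_map (by fun_prop) (by fun_prop)]
    rfl
  refine (condExp_comap_ae_eq_of_map_eq_withDensity (q := fun z => p (z.1 - u z.2)) (by fun_prop)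
    hζ (by fun_prop) (fun z => hp0 _) hjoint hv hvint).trans (Filter.Eventually.of_forall fun ω => ?_)
  simp only
  rw [integral_map hζ.aemeasurable (Measurable.aestronglyMeasurable (by fun_prop)),
    integral_map hζ.aemeasurable (Measurable.aestronglyMeasurable (by fun_prop))]
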